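/- Assume 0 < q < 1/2 and p = 1 − q. For every n ≥ 1, the sum of the weights p (pq)^{|w|} over all Dyck words w that end with the suffix S H H … H with exactly n letters H at the end (i.e., the last n+1 letters of w are one S followed by n H's) equals p q^n. -/

import Mathlib

/-- A Dyck word: every prefix has at least as many `S` (`true`) as `H` (`false`),
and the total numbers of `S` and `H` coincide. -/
def IsDyck (w : List Bool) : Prop :=
  w.count true = w.count false ∧
  ∀ n : ℕ, (w.take n).count false ≤ (w.take n).count true

def Pre (w : List Bool) : Prop := ∀ l, l <+: w → l.count false ≤ l.count true

theorem isDyck_iff (w : List Bool) : IsDyck w ↔ w.count true = w.count false ∧ Pre w := by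
  unfold IsDyck Pre
  refine and_congr_right fun _ => ⟨fun h l hl => ?_, fun h m => h _ (List.take_prefix _ _)⟩
  rw [List.prefix_iff_eq_take.1 hl]
  exact h _

theorem pre_concat (w : List Bool) (a : Bool) :
    Pre (w ++ [a]) ↔ Pre w ∧ (w ++ [a]).count false ≤ (w ++ [a]).count true := by
  unfold Pre
  simp only [List.prefix_concat_iff]
  constructor
  · intro h
    exact ⟨fun l hl => h l (Or.inr hl), h _ (Or.inl rfl)⟩
  · rintro ⟨h1, h2⟩ l (rfl | hl)
    · exact h2
    · exact h1 l hl

theorem pre_self {w : List Bool} (h : Pre w) : w.count false ≤ w.count true :=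
  h w (List.prefix_refl w)

theorem pre_nil : Pre [] := by
  intro l hl
  rw [List.prefix_nil.1 hl]
  simp

theorem pre_replicate (w : List Bool) (n : ℕ) :
    Pre (w ++ List.replicate n false) ↔ Pre w ∧ w.count false + n ≤ w.count true := by
  induction n with
  | zero => simpa using fun h => pre_self h
  | succ n ih =>
    rw [List.replicate_succ', ← List.append_assoc, pre_concat, ih]
    simp [List.count_append, List.count_replicate]
    grind

def Good (v : List Bool) (k : ℕ) : Prop :=
  Pre v.reverse ∧ v.count true = v.count false + k

theorem good_nil (k : ℕ) : Good [] k ↔ k = 0 := by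
  simp [Good, pre_nil, eq_comm]

theorem good_true_zero (v : List Bool) : ¬ Good (true :: v) 0 := by
  rintro ⟨h, h2⟩
  rw [List.reverse_cons, pre_concat] at h
  have := pre_self h.1
  simp at this h2
  omega

theorem good_true_succ (v : List Bool) (k : ℕ) : Good (true :: v) (k+1) ↔ Good v k := by
  unfold Good
  rw [List.reverse_cons, pre_concat]
  constructor
  · rintro ⟨h, h2⟩
    simp at h2
    exact ⟨h.1, by omega⟩
  · rintro ⟨h, h2⟩
    have := pre_self h
    simp at this ⊢
    exact ⟨⟨h, by omega⟩, by omega⟩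

theorem good_false (v : List Bool) (k : ℕ) : Good (false :: v) k ↔ Good v (k+1) := by
  unfold Good
  rw [List.reverse_cons, pre_concat]
  constructor
  · rintro ⟨h, h2⟩
    simp at h2
    exact ⟨h.1, by omega⟩
  · rintro ⟨h, h2⟩
    have := pre_self h
    simp at this ⊢
    exact ⟨⟨h, by omega⟩, by omega⟩

theorem dyck_iff_good (v : List Bool) (k : ℕ) :
    IsDyck (v.reverse ++ true :: List.replicate (k+1) false) ↔ Good v k := by
  have e : v.reverse ++ true :: List.replicate (k+1) false =
      (v.reverse ++ [true]) ++ List.replicate (k+1) false := by simp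
  rw [isDyck_iff, e, pre_replicate, pre_concat]
  unfold Good
  simp [List.count_append, List.count_replicate]
  constructor
  · rintro ⟨h, h2, h3⟩
    exact ⟨h2.1, by omega⟩
  · rintro ⟨h, h2⟩
    exact ⟨by omega, ⟨h, by omega⟩, by omega⟩

open Classical in
noncomputable def Wt (x : ℝ) (v : List Bool) (k : ℕ) : ℝ :=
  if Good v k then x ^ v.count true else 0

theorem wt_nil (x : ℝ) (k : ℕ) : Wt x [] k = if k = 0 then 1 else 0 := by
  simp [Wt, good_nil]

theorem wt_true_zero (x : ℝ) (v : List Bool) : Wt x (true :: v) 0 = 0 := by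
  rw [Wt, if_neg (good_true_zero v)]

theorem wt_true_succ (x : ℝ) (v : List Bool) (k : ℕ) :
    Wt x (true :: v) (k+1) = x * Wt x v k := by
  by_cases h : Good v k
  · rw [Wt, Wt, if_pos h, if_pos ((good_true_succ v k).2 h)]
    simp [pow_succ, mul_comm]
  · rw [Wt, Wt, if_neg h, if_neg (fun h' => h ((good_true_succ v k).1 h')), mul_zero]

theorem wt_false (x : ℝ) (v : List Bool) (k : ℕ) :
    Wt x (false :: v) k = Wt x v (k+1) := by
  by_cases h : Good v (k+1)
  · rw [Wt, Wt, if_pos h, if_pos ((good_false v k).2 h)]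
    simp
  · rw [Wt, Wt, if_neg h, if_neg (fun h' => h ((good_false v k).1 h'))]

theorem wt_nonneg {x : ℝ} (hx : 0 ≤ x) (v : List Bool) (k : ℕ) : 0 ≤ Wt x v k := by
  unfold Wt; split_ifs <;> positivity

def LL : ℕ → Finset (List Bool)
  | 0 => ∅
  | N+1 => insert [] ((LL N).image (List.cons true) ∪ (LL N).image (List.cons false))

theorem mem_LL (N : ℕ) (v : List Bool) : v ∈ LL N ↔ v.length < N := by
  induction N generalizing v with
  | zero => simp [LL]
  | succ N ih =>
    rcases v with _ | ⟨a, v⟩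
    · simp [LL]
    · cases a <;> simp [LL, ih]

theorem LL_tendsto : Filter.Tendsto LL Filter.atTop Filter.atTop := by
  apply Filter.tendsto_atTop_finset_of_monotone
  · intro a b hab v
    simp only [mem_LL]; omega
  · intro v
    exact ⟨v.length + 1, by simp [mem_LL]⟩

theorem sum_LL (f : List Bool → ℝ) (N : ℕ) :
    ∑ v ∈ LL (N+1), f v = f [] + (∑ v ∈ LL N, f (true :: v) + ∑ v ∈ LL N, f (false :: v)) := by
  rw [LL, Finset.sum_insert (by simp), Finset.sum_union, Finset.sum_image, Finset.sum_image]
  · intro a _ b _ h; simpa using h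
  · intro a _ b _ h; simpa using h
  · rw [Finset.disjoint_left]
    simp

theorem T_zero (x : ℝ) (N : ℕ) :
    ∑ v ∈ LL (N+1), Wt x v 0 = 1 + ∑ v ∈ LL N, Wt x v 1 := by
  rw [sum_LL]
  simp [wt_nil, wt_true_zero, wt_false]

theorem T_succ (x : ℝ) (N k : ℕ) :
    ∑ v ∈ LL (N+1), Wt x v (k+1) = x * ∑ v ∈ LL N, Wt x v k + ∑ v ∈ LL N, Wt x v (k+2) := by
  rw [sum_LL]
  simp [wt_nil, wt_true_succ, wt_false, Finset.mul_sum]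

theorem T_le (q p : ℝ) (hq : 0 < q) (hq1 : q < 1 / 2) (hp : p = 1 - q) (N k : ℕ) :
    ∑ v ∈ LL N, Wt (p*q) v k ≤ q ^ k / p := by
  have hp0 : 0 < p := by linarith
  induction N generalizing k with
  | zero => simp [LL]; positivity
  | succ N ih =>
    rcases k with _ | k
    · rw [T_zero]
      have : q ^ 0 / p = 1 + q ^ 1 / p := by field_simp; linarith
      rw [this]; linarith [ih 1]
    · rw [T_succ]
      have : q ^ (k+1) / p = p * q * (q ^ k / p) + q ^ (k+2) / p := by
        field_simp; rw [hp]; ring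
      rw [this]
      have := mul_le_mul_of_nonneg_left (ih k) (by positivity : 0 ≤ p * q)
      linarith [ih (k+2)]

theorem hasSum_Wt (q p : ℝ) (hq : 0 < q) (hq1 : q < 1 / 2) (hp : p = 1 - q) (k : ℕ) :
    HasSum (fun v => Wt (p*q) v k) (q ^ k / p) := by
  have hp0 : 0 < p := by linarith
  have hx : 0 ≤ p * q := by positivity
  have hs : ∀ k, Summable (fun v => Wt (p*q) v k) := by
    intro k
    refine summable_of_sum_le (c := q ^ k / p) (fun v => wt_nonneg hx v k) fun s => ?_
    obtain ⟨N, hN⟩ := (LL_tendsto.eventually_ge_atTop s).exists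
    exact (Finset.sum_le_sum_of_subset_of_nonneg hN fun v _ _ => wt_nonneg hx v k).trans
      (T_le q p hq hq1 hp N k)
  set G : ℕ → ℝ := fun k => ∑' v, Wt (p*q) v k with hG
  have ht : ∀ k, Filter.Tendsto (fun N => ∑ v ∈ LL N, Wt (p*q) v k) Filter.atTop
      (nhds (G k)) := fun k => (hs k).hasSum.comp LL_tendsto
  have ht1 : ∀ k, Filter.Tendsto (fun N => ∑ v ∈ LL (N+1), Wt (p*q) v k) Filter.atTop
      (nhds (G k)) := fun k => (ht k).comp (Filter.tendsto_add_atTop_nat 1)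
  have hle : ∀ k, G k ≤ q ^ k / p := fun k =>
    le_of_tendsto' (ht k) fun N => T_le q p hq hq1 hp N k
  have hG0 : ∀ k, 0 ≤ G k := fun k => tsum_nonneg fun v => wt_nonneg hx v k
  have h0 : G 0 = 1 + G 1 := by
    refine tendsto_nhds_unique (ht1 0) ?_
    simp only [T_zero]
    exact (ht 1).const_add 1
  have h1 : ∀ k, G (k+1) = p * q * G k + G (k+2) := by
    intro k
    refine tendsto_nhds_unique (ht1 (k+1)) ?_
    simp only [T_succ]
    exact ((ht k).const_mul _).add (ht (k+2))
  set D : ℕ → ℝ := fun k => q ^ k / p - G k with hD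
  have d0 : D 1 = D 0 := by
    simp only [hD, h0]; field_simp; rw [hp]; ring
  have d1 : ∀ k, D (k+2) = D (k+1) - p * q * D k := by
    intro k
    simp only [hD]
    have := h1 k
    have h2 : q ^ (k+1) / p = p * q * (q ^ k / p) + q ^ (k+2) / p := by
      field_simp; rw [hp]; ring
    linarith
  have d2 : ∀ k, D (k+1) - q * D k = p ^ (k+1) * D 0 := by
    intro k
    induction k with
    | zero => rw [d0, hp]; ring
    | succ k ih =>
      have : D (k+1+1) - q * D (k+1) = p * (D (k+1) - q * D k) := by
        rw [d1 k, hp]; ring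
      rw [this, ih]; ring
  have dn : ∀ k, 0 ≤ D k := fun k => sub_nonneg.2 (hle k)
  have du : ∀ k, D k ≤ q ^ k / p := fun k => by simp only [hD]; linarith [hG0 k]
  have c0 : D 0 = 0 := by
    apply le_antisymm _ (dn 0)
    have hb : ∀ k : ℕ, D 0 ≤ (q/p) ^ (k+1) / p := by
      intro k
      have e := d2 k
      have := du (k+1)
      have h3 := mul_nonneg hq.le (dn k)
      have : p ^ (k+1) * D 0 ≤ q ^ (k+1) / p := by linarith
      rw [div_pow, div_div, mul_comm, ← div_div, le_div_iff₀ (by positivity)]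
      linarith
    have hl : Filter.Tendsto (fun k : ℕ => (q/p) ^ (k+1) / p) Filter.atTop (nhds (0 / p)) :=
      ((tendsto_pow_atTop_nhds_zero_of_lt_one (by positivity)
        ((div_lt_one hp0).2 (by linarith))).comp (Filter.tendsto_add_atTop_nat 1)).div_const p
    rw [zero_div] at hl
    exact ge_of_tendsto' hl hb
  have dz : ∀ k, D k = 0 := by
    intro k
    induction k with
    | zero => exact c0
    | succ k ih => have := d2 k; rw [ih, c0] at this; linarith
  have : q ^ k / p = G k := sub_eq_zero.1 (dz k)
  rw [this]
  exact (hs k).hasSum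

theorem stmt7 (q p : ℝ) (hq : 0 < q) (hq1 : q < 1 / 2) (hp : p = 1 - q)
    (n : ℕ) (hn : 1 ≤ n) :
    HasSum
      (fun w : {w : List Bool //
          IsDyck w ∧ ∃ u : List Bool, w = u ++ true :: List.replicate n false} =>
        p * (p * q) ^ ((w : List Bool).count true))
      (p * q ^ n) := by
  classical
  have hp0 : 0 < p := by linarith
  obtain ⟨k, rfl⟩ : ∃ k, n = k + 1 := ⟨n - 1, by omega⟩
  refine (hasSum_subtype_iff_indicator (s := {w : List Bool |
          IsDyck w ∧ ∃ u : List Bool, w = u ++ true :: List.replicate (k+1) false})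
    (f := fun w : List Bool => p * (p * q) ^ (w.count true))).2 ?_
  have hinj : Function.Injective
      (fun v : List Bool => v.reverse ++ true :: List.replicate (k+1) false) := by
    intro a b h
    simpa using h
  rw [← hinj.hasSum_iff]
  · have := (hasSum_Wt q p hq hq1 hp k).mul_left (p * (p * q))
    have e2 : p * (p * q) * (q ^ k / p) = p * q ^ (k+1) := by field_simp; ring
    rw [e2] at this
    refine (congrArg (fun f => HasSum f (p * q ^ (k+1))) ?_).mpr this
    · funext v
      by_cases hv : Good v k
      · have : (v.reverse ++ true :: List.replicate (k+1) false) ∈ {w : List Bool |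
          IsDyck w ∧ ∃ u : List Bool, w = u ++ true :: List.replicate (k+1) false} :=
          ⟨(dyck_iff_good v k).2 hv, _, rfl⟩
        rw [Function.comp_apply, Set.indicator_of_mem this, Wt, if_pos hv]
        simp [List.count_append, List.count_replicate]
        ring
      · have : (v.reverse ++ true :: List.replicate (k+1) false) ∉ {w : List Bool |
          IsDyck w ∧ ∃ u : List Bool, w = u ++ true :: List.replicate (k+1) false} :=
          fun h => hv ((dyck_iff_good v k).1 h.1)
        rw [Function.comp_apply, Set.indicator_of_notMem this, Wt, if_neg hv, mul_zero]
  · intro w hw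
    apply Set.indicator_of_notMem
    rintro ⟨_, u, rfl⟩
    exact hw ⟨u.reverse, by simp⟩
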